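/- Let (V, R, 𝔤) be a symmetric holonomy system and suppose there is a real number λ ≠ 0 such that B′(x,y) = λ⟨x,y⟩ for all x, y ∈ V. Then for all x, y, z, w ∈ V: −λ·⟨(R(x,y))(z), w⟩ = κ(R(x,y), R(z,w)) + tr(R(x,y) ∘ R(z,w)), where the last trace is taken over V. -/

import Mathlib

open RealInnerProductSpace

/-- The bracket on 𝔍 = 𝔤 ⊕ V for a symmetric holonomy system:
`[(A,x),(A′,y)] = ([A,A′] − R(x,y), A(y) − A′(x))`. -/
def brkJ {V : Type} [NormedAddCommGroup V] [InnerProductSpace ℝ V]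
    (g : Submodule ℝ (V →ₗ[ℝ] V))
    (hg : ∀ A ∈ g, ∀ B ∈ g, A ∘ₗ B - B ∘ₗ A ∈ g)
    (R : V →ₗ[ℝ] V →ₗ[ℝ] (V →ₗ[ℝ] V)) (hR : ∀ x y : V, R x y ∈ g) :
    (↥g × V) → (↥g × V) → (↥g × V) :=
  fun u v =>
    (⟨u.1.1 ∘ₗ v.1.1 - v.1.1 ∘ₗ u.1.1 - R u.2 v.2,
      sub_mem (hg _ u.1.2 _ v.1.2) (hR u.2 v.2)⟩,
     u.1.1 v.2 - v.1.1 u.2)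

/-- `ad_u : 𝔍 → 𝔍`, as a linear map. -/
def adJ {V : Type} [NormedAddCommGroup V] [InnerProductSpace ℝ V]
    (g : Submodule ℝ (V →ₗ[ℝ] V))
    (hg : ∀ A ∈ g, ∀ B ∈ g, A ∘ₗ B - B ∘ₗ A ∈ g)
    (R : V →ₗ[ℝ] V →ₗ[ℝ] (V →ₗ[ℝ] V)) (hR : ∀ x y : V, R x y ∈ g)
    (u : ↥g × V) : (↥g × V) →ₗ[ℝ] (↥g × V) where
  toFun v := brkJ g hg R hR u v
  map_add' v w := by
    refine Prod.ext (Subtype.ext ?_) ?_ <;>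
      simp [brkJ, LinearMap.comp_add, LinearMap.add_comp] <;> abel
  map_smul' c v := by
    refine Prod.ext (Subtype.ext ?_) ?_ <;>
      simp [brkJ, LinearMap.comp_smul, LinearMap.smul_comp, smul_sub] <;> abel

/-- The form `B′(u,v) = tr(ad_u ∘ ad_v)` on 𝔍. -/
noncomputable def Bform {V : Type} [NormedAddCommGroup V] [InnerProductSpace ℝ V]
    (g : Submodule ℝ (V →ₗ[ℝ] V))
    (hg : ∀ A ∈ g, ∀ B ∈ g, A ∘ₗ B - B ∘ₗ A ∈ g)
    (R : V →ₗ[ℝ] V →ₗ[ℝ] (V →ₗ[ℝ] V)) (hR : ∀ x y : V, R x y ∈ g)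
    (u v : ↥g × V) : ℝ :=
  LinearMap.trace ℝ (↥g × V) (adJ g hg R hR u ∘ₗ adJ g hg R hR v)

/-- `ad` within 𝔤. -/
def adg {V : Type} [NormedAddCommGroup V] [InnerProductSpace ℝ V]
    (g : Submodule ℝ (V →ₗ[ℝ] V))
    (hg : ∀ A ∈ g, ∀ B ∈ g, A ∘ₗ B - B ∘ₗ A ∈ g)
    (A : ↥g) : ↥g →ₗ[ℝ] ↥g where
  toFun B := ⟨A.1 ∘ₗ B.1 - B.1 ∘ₗ A.1, hg _ A.2 _ B.2⟩
  map_add' B C := by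
    refine Subtype.ext ?_
    simp [LinearMap.comp_add, LinearMap.add_comp]
    abel
  map_smul' c B := by
    refine Subtype.ext ?_
    simp [LinearMap.comp_smul, LinearMap.smul_comp, smul_sub]

/-- The Killing form `κ` of the Lie algebra 𝔤. -/
noncomputable def killing {V : Type} [NormedAddCommGroup V] [InnerProductSpace ℝ V]
    (g : Submodule ℝ (V →ₗ[ℝ] V))
    (hg : ∀ A ∈ g, ∀ B ∈ g, A ∘ₗ B - B ∘ₗ A ∈ g)
    (A B : ↥g) : ℝ :=
  LinearMap.trace ℝ ↥g (adg g hg A ∘ₗ adg g hg B)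

/-- On elements of `𝔤`, the form `B′` is the sum of the Killing form and the trace form. -/
theorem Bform_inl_inl {V : Type} [NormedAddCommGroup V] [InnerProductSpace ℝ V]
    (g : Submodule ℝ (V →ₗ[ℝ] V))
    (hg : ∀ A ∈ g, ∀ B ∈ g, A ∘ₗ B - B ∘ₗ A ∈ g)
    (R : V →ₗ[ℝ] V →ₗ[ℝ] (V →ₗ[ℝ] V)) (hR : ∀ x y : V, R x y ∈ g) [FiniteDimensional ℝ V]
    (A B : ↥g) :
    Bform g hg R hR (A, 0) (B, 0)
      = killing g hg A B + LinearMap.trace ℝ V (A.1 ∘ₗ B.1) := by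
  rw [Bform, killing, ← LinearMap.trace_prodMap']
  congr 1
  refine LinearMap.ext fun v => Prod.ext (Subtype.ext ?_) ?_ <;> simp [adJ, brkJ, adg]

/-- The Jacobi identity `ad_{[A,z]} = [ad_A, ad_z]` for `A ∈ 𝔤` and `z ∈ V`. -/
theorem adJ_inr_apply {V : Type} [NormedAddCommGroup V] [InnerProductSpace ℝ V]
    (g : Submodule ℝ (V →ₗ[ℝ] V))
    (hg : ∀ A ∈ g, ∀ B ∈ g, A ∘ₗ B - B ∘ₗ A ∈ g)
    (R : V →ₗ[ℝ] V →ₗ[ℝ] (V →ₗ[ℝ] V)) (hR : ∀ x y : V, R x y ∈ g)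
    (hS1 : ∀ A ∈ g, ∀ x y : V,
      A ∘ₗ R x y - R x y ∘ₗ A = R (A x) y + R x (A y))
    (A : ↥g) (z : V) :
    adJ g hg R hR (0, A.1 z)
      = adJ g hg R hR (A, 0) ∘ₗ adJ g hg R hR (0, z)
        - adJ g hg R hR (0, z) ∘ₗ adJ g hg R hR (A, 0) := by
  refine LinearMap.ext fun v => Prod.ext (Subtype.ext ?_) ?_
  · have h := hS1 A.1 A.2 z v.2
    simp [adJ, brkJ, LinearMap.comp_neg, LinearMap.neg_comp]
    rw [eq_sub_of_add_eq h.symm]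
    abel
  · simp [adJ, brkJ]
    abel

/-- The Jacobi identity `ad_{[z,w]} = [ad_z, ad_w]` for `z, w ∈ V`, where `[z,w] = -R(z,w)`. -/
theorem adJ_inl_curvature {V : Type} [NormedAddCommGroup V] [InnerProductSpace ℝ V]
    (g : Submodule ℝ (V →ₗ[ℝ] V))
    (hg : ∀ A ∈ g, ∀ B ∈ g, A ∘ₗ B - B ∘ₗ A ∈ g)
    (R : V →ₗ[ℝ] V →ₗ[ℝ] (V →ₗ[ℝ] V)) (hR : ∀ x y : V, R x y ∈ g)
    (hRalt : ∀ x : V, R x x = 0)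
    (hB1 : ∀ x y z : V, R x y z + R y z x + R z x y = 0)
    (hS1 : ∀ A ∈ g, ∀ x y : V,
      A ∘ₗ R x y - R x y ∘ₗ A = R (A x) y + R x (A y))
    (z w : V) :
    adJ g hg R hR (⟨R z w, hR z w⟩, 0)
      = adJ g hg R hR (0, w) ∘ₗ adJ g hg R hR (0, z)
        - adJ g hg R hR (0, z) ∘ₗ adJ g hg R hR (0, w) := by
  have hswap (x y : V) : R x y = -R y x := (LinearMap.IsAlt.neg hRalt y x).symm
  refine LinearMap.ext fun v => Prod.ext (Subtype.ext ?_) ?_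
  · have h := hS1 v.1.1 v.1.2 z w
    rw [hswap (v.1.1 z) w] at h
    simp [adJ, brkJ]
    rw [← neg_sub, h]
    abel
  · have h := hB1 z w v.2
    rw [hswap v.2 z, LinearMap.neg_apply] at h
    simp [adJ, brkJ]
    rw [← sub_eq_zero, ← h]
    abel

/-- Associativity of the trace form: `tr(a[b,c]) = -tr([a,c]b)`. -/
theorem trace_comp_commutator {K M : Type*} [CommRing K] [AddCommGroup M] [Module K M]
    (a b c : M →ₗ[K] M) :
    LinearMap.trace K M (a ∘ₗ (b ∘ₗ c - c ∘ₗ b))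
      = -LinearMap.trace K M ((a ∘ₗ c - c ∘ₗ a) ∘ₗ b) := by
  simp only [← Module.End.mul_eq_comp, mul_sub, sub_mul, map_sub, neg_sub]
  rw [← mul_assoc, LinearMap.trace_mul_comm, mul_assoc c a b, mul_assoc a c b]

/-- Invariance of `B′`: `B′(A, R(z,w)) = -B′(A z, w)`. -/
theorem Bform_inl_curvature {V : Type} [NormedAddCommGroup V] [InnerProductSpace ℝ V]
    (g : Submodule ℝ (V →ₗ[ℝ] V))
    (hg : ∀ A ∈ g, ∀ B ∈ g, A ∘ₗ B - B ∘ₗ A ∈ g)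
    (R : V →ₗ[ℝ] V →ₗ[ℝ] (V →ₗ[ℝ] V)) (hR : ∀ x y : V, R x y ∈ g)
    (hRalt : ∀ x : V, R x x = 0)
    (hB1 : ∀ x y z : V, R x y z + R y z x + R z x y = 0)
    (hS1 : ∀ A ∈ g, ∀ x y : V,
      A ∘ₗ R x y - R x y ∘ₗ A = R (A x) y + R x (A y))
    (A : ↥g) (z w : V) :
    Bform g hg R hR (A, 0) (⟨R z w, hR z w⟩, 0)
      = -Bform g hg R hR (0, A.1 z) (0, w) := by
  rw [Bform, Bform, adJ_inr_apply g hg R hR hS1, adJ_inl_curvature g hg R hR hRalt hB1 hS1,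
    trace_comp_commutator]

/-- Kostant's formula: for a symmetric holonomy system with `B′|_V = λ⟨·,·⟩`, `λ ≠ 0`,
one has `−λ⟨R(x,y)z, w⟩ = κ(R(x,y), R(z,w)) + tr(R(x,y) ∘ R(z,w))`. -/
theorem kostant_curvature_formula
    {V : Type} [NormedAddCommGroup V] [InnerProductSpace ℝ V]
    [FiniteDimensional ℝ V] [Nontrivial V]
    (g : Submodule ℝ (V →ₗ[ℝ] V))
    (hg_lie : ∀ A ∈ g, ∀ B ∈ g, A ∘ₗ B - B ∘ₗ A ∈ g)
    (hg_skew : ∀ A ∈ g, ∀ x y : V, ⟪A x, y⟫ = -⟪x, A y⟫)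
    (R : V →ₗ[ℝ] V →ₗ[ℝ] (V →ₗ[ℝ] V)) (hRg : ∀ x y : V, R x y ∈ g)
    (hRalt : ∀ x : V, R x x = 0)
    (hB1 : ∀ x y z : V, R x y z + R y z x + R z x y = 0)
    (hS1 : ∀ A ∈ g, ∀ x y : V,
      A ∘ₗ R x y - R x y ∘ₗ A = R (A x) y + R x (A y))
    (lam : ℝ) (hlam : lam ≠ 0)
    (hBV : ∀ x y : V,
      Bform g hg_lie R hRg ((0 : ↥g), x) ((0 : ↥g), y) = lam * ⟪x, y⟫) :
    ∀ x y z w : V,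
      -lam * ⟪R x y z, w⟫
        = killing g hg_lie ⟨R x y, hRg x y⟩ ⟨R z w, hRg z w⟩
            + LinearMap.trace ℝ V (R x y ∘ₗ R z w) := by
  intro x y z w
  rw [← Bform_inl_inl g hg_lie R hRg,
    Bform_inl_curvature g hg_lie R hRg hRalt hB1 hS1, hBV, neg_mul]
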